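/- (Lemma 4.3, case (i).) Let α be a smooth curve in the Galilean 3-space G₃ parametrized by Galilean arc length, with Galilean Frenet frame {T, N, B}, curvature κ and torsion τ, and let φ(s,t) = α(s) + tB(s) be the binormal surface along α. If the Gaussian curvature of φ is a negative constant, i.e. there exists c > 0 with K(s,t) = −c for all (s,t) ∈ I × ℝ, then the torsion τ is constant on I (namely τ ≡ √c or τ ≡ −√c), so α is a curve of constant torsion (an anti-Salkowski curve when κ is non-constant). -/

import Mathlib

noncomputable section

/-- The Galilean cross product of two vectors in `G₃` (modeled on `Fin 3 → ℝ`):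
`x ∧ y = (0, x₃y₁ − x₁y₃, x₁y₂ − x₂y₁)`. -/
def gcross (x y : Fin 3 → ℝ) : Fin 3 → ℝ :=
  ![0, x 2 * y 0 - x 0 * y 2, x 0 * y 1 - x 1 * y 0]

/-- The Galilean scalar product of two isotropic vectors: the Euclidean dot product
of their last two components. -/
def gdot (x y : Fin 3 → ℝ) : ℝ := x 1 * y 1 + x 2 * y 2

/-- The Galilean norm of an isotropic vector. -/
def gnorm (x : Fin 3 → ℝ) : ℝ := Real.sqrt (gdot x x)

/-- Partial derivative of a parametrized surface with respect to the first parameter. -/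
def pderivS (φ : ℝ → ℝ → (Fin 3 → ℝ)) (s t : ℝ) : Fin 3 → ℝ :=
  deriv (fun u => φ u t) s

/-- Partial derivative of a parametrized surface with respect to the second parameter. -/
def pderivT (φ : ℝ → ℝ → (Fin 3 → ℝ)) (s t : ℝ) : Fin 3 → ℝ :=
  deriv (fun v => φ s v) t

/-- `w = ‖φ_s ∧ φ_t‖`, the Galilean norm of the cross product of the partials. -/
def wfun (φ : ℝ → ℝ → (Fin 3 → ℝ)) (s t : ℝ) : ℝ :=
  gnorm (gcross (pderivS φ s t) (pderivT φ s t))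

/-- The unit isotropic normal `η = (φ_s ∧ φ_t)/w` of the surface `φ`. -/
def unitNormal (φ : ℝ → ℝ → (Fin 3 → ℝ)) (s t : ℝ) : Fin 3 → ℝ :=
  (wfun φ s t)⁻¹ • gcross (pderivS φ s t) (pderivT φ s t)

/-- Second fundamental form coefficient `L₁₁ = ⟨φ_ss, η⟩`. -/
def L11 (φ : ℝ → ℝ → (Fin 3 → ℝ)) (s t : ℝ) : ℝ :=
  gdot (pderivS (pderivS φ) s t) (unitNormal φ s t)

/-- Second fundamental form coefficient `L₁₂ = ⟨φ_st, η⟩`. -/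
def L12 (φ : ℝ → ℝ → (Fin 3 → ℝ)) (s t : ℝ) : ℝ :=
  gdot (pderivS (pderivT φ) s t) (unitNormal φ s t)

/-- Second fundamental form coefficient `L₂₂ = ⟨φ_tt, η⟩`. -/
def L22 (φ : ℝ → ℝ → (Fin 3 → ℝ)) (s t : ℝ) : ℝ :=
  gdot (pderivT (pderivT φ) s t) (unitNormal φ s t)

/-- Gaussian curvature `K = (L₁₁L₂₂ − L₁₂²)/w²`. -/
def Kgauss (φ : ℝ → ℝ → (Fin 3 → ℝ)) (s t : ℝ) : ℝ :=
  (L11 φ s t * L22 φ s t - (L12 φ s t) ^ 2) / (wfun φ s t) ^ 2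

/-- Mean curvature of the ruled surface `φ` (with `g₁ = 1`, `g₂ = 0`): `H = L₂₂/(2w²)`. -/
def Hmean (φ : ℝ → ℝ → (Fin 3 → ℝ)) (s t : ℝ) : ℝ :=
  L22 φ s t / (2 * (wfun φ s t) ^ 2)

lemma tangent_zero_eq_one {α : ℝ → (Fin 3 → ℝ)} {I : Set ℝ} (hI : IsOpen I)
    (hα0 : ∀ s ∈ I, α s 0 = s) {s : ℝ} (hs : s ∈ I) {v : Fin 3 → ℝ}
    (hv : HasDerivAt α v s) : v 0 = 1 :=
  (hasDerivAt_pi.1 hv 0).unique <|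
    (hasDerivAt_id s).congr_of_eventuallyEq <|
      Filter.eventually_of_mem (hI.mem_nhds hs) fun u hu => hα0 u hu

lemma pderivT_ruled (α B : ℝ → (Fin 3 → ℝ)) :
    pderivT (fun s t => α s + t • B s) = fun s _ => B s := by
  funext s t
  simpa [pderivT] using (((hasDerivAt_id t).smul_const (B s)).const_add (α s)).deriv

lemma pderivS_ruled {α B : ℝ → (Fin 3 → ℝ)} {a b : Fin 3 → ℝ} {s : ℝ}
    (hα : HasDerivAt α a s) (hB : HasDerivAt B b s) (t : ℝ) :
    pderivS (fun s t => α s + t • B s) s t = a + t • b :=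
  (hα.add (hB.const_smul t)).deriv

/-- The Gaussian curvature of the binormal surface is `-τ²`. -/
lemma Kgauss_binormal_surface {α B : ℝ → (Fin 3 → ℝ)} {T N : Fin 3 → ℝ} {s τ : ℝ}
    (hα : HasDerivAt α T s) (hB : HasDerivAt B ((-τ) • N) s) (hT : T 0 = 1) (hN : N 0 = 0)
    (hNunit : gdot N N = 1) (hBdef : B s = gcross T N) (t : ℝ) :
    Kgauss (fun s t => α s + t • B s) s t = -τ ^ 2 := by
  have hN' : N 1 * N 1 + N 2 * N 2 = 1 := hNunit
  have hB0 : B s 0 = 0 := by simp [hBdef, gcross]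
  have hB1 : B s 1 = -N 2 := by simp [hBdef, gcross, hT, hN]
  have hB2 : B s 2 = N 1 := by simp [hBdef, gcross, hT, hN]
  have hcross : gcross (pderivS (fun s t => α s + t • B s) s t)
      (pderivT (fun s t => α s + t • B s) s t) = ![0, -N 1, -N 2] := by
    rw [pderivS_ruled hα hB, pderivT_ruled]
    simp [gcross, hB0, hB1, hB2, hT, hN]
  have hw : wfun (fun s t => α s + t • B s) s t = 1 := by
    rw [wfun, hcross]
    simp [gnorm, gdot, hN']
  have hη : unitNormal (fun s t => α s + t • B s) s t = ![0, -N 1, -N 2] := by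
    rw [unitNormal, hw, hcross, inv_one, one_smul]
  have h22 : L22 (fun s t => α s + t • B s) s t = 0 := by
    rw [L22, pderivT_ruled]
    simp [pderivT, gdot]
  have h12 : L12 (fun s t => α s + t • B s) s t = τ := by
    have hst : pderivS (pderivT (fun s t => α s + t • B s)) s t = (-τ) • N := by
      rw [pderivT_ruled]
      exact hB.deriv
    rw [L12, hst, hη]
    simp only [gdot, Pi.smul_apply, smul_eq_mul, Matrix.cons_val]
    linear_combination τ * hN'
  rw [Kgauss, hw, h22, h12]
  ring

theorem binormal_surface_constant_negative_curvature_constant_torsion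
    (I : Set ℝ) (hI : ∃ a b : ℝ, I = Set.Ioo a b)
    (α T N B : ℝ → (Fin 3 → ℝ)) (κ τ : ℝ → ℝ)
    (hαsm : ContDiffOn ℝ (⊤ : ℕ∞) α I) (hNsm : ContDiffOn ℝ (⊤ : ℕ∞) N I) (hBsm : ContDiffOn ℝ (⊤ : ℕ∞) B I)
    (hκsm : ContDiffOn ℝ (⊤ : ℕ∞) κ I) (hτsm : ContDiffOn ℝ (⊤ : ℕ∞) τ I)
    (hα0 : ∀ s ∈ I, α s 0 = s)
    (hT : ∀ s ∈ I, HasDerivAt α (T s) s)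
    (hNiso : ∀ s ∈ I, N s 0 = 0) (hBiso : ∀ s ∈ I, B s 0 = 0)
    (hNunit : ∀ s ∈ I, gdot (N s) (N s) = 1) (hBunit : ∀ s ∈ I, gdot (B s) (B s) = 1)
    (hNB : ∀ s ∈ I, gdot (N s) (B s) = 0)
    (hBdef : ∀ s ∈ I, B s = gcross (T s) (N s))
    (hFrenetT : ∀ s ∈ I, HasDerivAt T (κ s • N s) s)
    (hFrenetN : ∀ s ∈ I, HasDerivAt N (τ s • B s) s)
    (hFrenetB : ∀ s ∈ I, HasDerivAt B ((-τ s) • N s) s)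
    (φ : ℝ → ℝ → (Fin 3 → ℝ)) (hφ : ∀ s t : ℝ, φ s t = α s + t • B s)
    (c : ℝ) (hc : 0 < c)
    (hK : ∀ s ∈ I, ∀ t : ℝ, Kgauss φ s t = -c) :
    (∀ s ∈ I, τ s = Real.sqrt c) ∨ (∀ s ∈ I, τ s = -Real.sqrt c) := by
  obtain ⟨a, b, rfl⟩ := hI
  obtain rfl : φ = fun s t => α s + t • B s := funext fun s => funext fun t => hφ s t
  have hsq : Set.EqOn (τ ^ 2) ((fun _ => Real.sqrt c) ^ 2) (Set.Ioo a b) := fun s hs => by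
    have hKτ := Kgauss_binormal_surface (hT s hs) (hFrenetB s hs)
      (tangent_zero_eq_one isOpen_Ioo hα0 hs (hT s hs)) (hNiso s hs) (hNunit s hs)
      (hBdef s hs) 0
    rw [hK s hs 0] at hKτ
    simp only [Pi.pow_apply, Real.sq_sqrt hc.le]
    linarith
  exact isPreconnected_Ioo.eq_or_eq_neg_of_sq_eq hτsm.continuousOn continuousOn_const hsq
    fun _ => (Real.sqrt_pos.2 hc).ne'

end
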